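/- arXiv:2504.11715 — 3 statements merged into one kernel-verified Lean document; each statement's English description precedes it below -/
import Mathlib

section
/- For every Λ > 0 with Λ ∉ {α_n(0) : n ∈ ℕ}, there exist δ > 0 and N ∈ ℕ such that for all t ∈ [0, δ] and all n ≥ N one has α_n(t) > Λ. -/
/-- Lemma 3.2: under Hypothesis (A), for every `Λ > 0` not among the eigenvalues
`α n 0`, eventually (both in `t` near `0` and in `n`) the eigenvalues `α n t`
exceed `Λ`. -/
theorem spectral_gap_uniform
    (α : ℕ → ℝ → ℝ)
    (hcont : ∀ n, ContinuousOn (α n) (Set.Icc (0 : ℝ) 1))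
    (hnonneg : ∀ n, ∀ t ∈ Set.Icc (0 : ℝ) 1, 0 ≤ α n t)
    (hmono : Monotone fun n => α n 0)
    (htend : ∀ t ∈ Set.Icc (0 : ℝ) 1,
      Filter.Tendsto (fun n => α n t) Filter.atTop Filter.atTop)
    (hcard : ∀ Λ : ℝ, 0 < Λ → ∃ δ > 0, ∀ t ∈ Set.Ico (0 : ℝ) δ, t ∈ Set.Icc (0 : ℝ) 1 →
      ((Set.range fun n => α n t) ∩ Set.Icc 0 Λ).ncard
        = ((Set.range fun n => α n 0) ∩ Set.Icc 0 Λ).ncard)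
    (Λ : ℝ) (hΛ : 0 < Λ) (hΛnotin : Λ ∉ Set.range fun n => α n 0) :
    ∃ δ > 0, ∃ N : ℕ, ∀ t ∈ Set.Icc (0 : ℝ) δ, t ∈ Set.Icc (0 : ℝ) 1 →
      ∀ n ≥ N, Λ < α n t := by
  obtain ⟨δ₁, hδ₁, hc⟩ := hcard Λ hΛ
  have h0 : (0 : ℝ) ∈ Set.Icc (0 : ℝ) 1 := ⟨le_rfl, zero_le_one⟩
  have hfin : ∀ t ∈ Set.Icc (0 : ℝ) 1,
      ((Set.range fun n => α n t) ∩ Set.Icc 0 Λ).Finite := by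
    intro t ht
    obtain ⟨M, hM⟩ := Filter.eventually_atTop.1 ((htend t ht).eventually_gt_atTop Λ)
    refine ((Set.finite_Iio M).image fun n => α n t).subset ?_
    rintro _ ⟨⟨n, rfl⟩, hn⟩
    exact ⟨n, not_le.1 fun h => (hM n h).not_ge hn.2, rfl⟩
  set A := (Set.range fun n => α n 0) ∩ Set.Icc 0 Λ
  have hAfin : A.Finite := hfin 0 h0
  have hrep : ∀ a : ℝ, ∃ n, a ∈ A → α n 0 = a := by
    intro a
    by_cases h : a ∈ A
    · obtain ⟨n, hn⟩ := h.1
      exact ⟨n, fun _ => hn⟩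
    · exact ⟨0, fun h' => absurd h' h⟩
  choose g hg using hrep
  have hlim : ∀ a ∈ A, Filter.Tendsto (α (g a)) (nhdsWithin 0 (Set.Icc 0 1)) (nhds a) := by
    intro a ha
    have h := hcont (g a) 0 h0
    rwa [ContinuousWithinAt, hg a ha] at h
  have hbelow : ∀ᶠ t in nhdsWithin (0 : ℝ) (Set.Icc 0 1), ∀ a ∈ A, α (g a) t < Λ := by
    refine (Filter.eventually_all_finite hAfin).2 fun a ha => (hlim a ha).eventually_lt_const ?_
    exact lt_of_le_of_ne ha.2.2 fun h => hΛnotin (h ▸ ha.1)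
  have hinj : ∀ᶠ t in nhdsWithin (0 : ℝ) (Set.Icc 0 1),
      ∀ a ∈ A, ∀ b ∈ A, a ≠ b → α (g a) t ≠ α (g b) t := by
    refine (Filter.eventually_all_finite hAfin).2 fun a ha =>
      (Filter.eventually_all_finite hAfin).2 fun b hb => ?_
    by_cases hab : a = b
    · exact .of_forall fun _ h => absurd hab h
    · exact (((hlim a ha).sub (hlim b hb)).eventually_ne (sub_ne_zero.2 hab)).mono
        fun _ h _ => sub_ne_zero.1 h
  obtain ⟨δ₂, hδ₂, hball⟩ := Metric.mem_nhdsWithin_iff.1 (hbelow.and hinj)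
  obtain ⟨N, hN⟩ := Filter.eventually_atTop.1 ((htend 0 h0).eventually_gt_atTop Λ)
  refine ⟨min δ₁ δ₂ / 2, by positivity, N, fun t ht ht1 n hn => ?_⟩
  by_contra! hle
  -- By the intermediate value theorem `α n` attains `Λ` at some `s ≤ t`, one value too many.
  obtain ⟨s, hs, hsΛ⟩ := intermediate_value_Icc' ht.1
    ((hcont n).mono (Set.Icc_subset_Icc_right ht1.2)) ⟨hle, (hN n hn).le⟩
  have hs1 : s ∈ Set.Icc (0 : ℝ) 1 := ⟨hs.1, hs.2.trans ht1.2⟩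
  have hsmin : s < min δ₁ δ₂ := by
    have : 0 < min δ₁ δ₂ := lt_min hδ₁ hδ₂
    linarith [hs.2, ht.2]
  have hsball : s ∈ Metric.ball (0 : ℝ) δ₂ := by
    rw [Metric.mem_ball, Real.dist_0_eq_abs, abs_of_nonneg hs.1]
    exact hsmin.trans_le (min_le_right _ _)
  obtain ⟨hsbelow, hsinj⟩ := hball ⟨hsball, hs1⟩
  have hcs := hc s ⟨hs.1, hsmin.trans_le (min_le_left _ _)⟩ hs1
  set B := (Set.range fun n => α n s) ∩ Set.Icc 0 Λ
  have hBfin : B.Finite := hfin s hs1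
  have hΛB : Λ ∈ B := ⟨⟨n, hsΛ⟩, hΛ.le, le_rfl⟩
  have hAB : A.ncard ≤ (B \ {Λ}).ncard := by
    refine Set.ncard_le_ncard_of_injOn (fun a => α (g a) s) (fun a ha => ?_)
      (fun a ha b hb h => ?_) hBfin.sdiff
    · exact ⟨⟨⟨g a, rfl⟩, hnonneg _ s hs1, (hsbelow a ha).le⟩, (hsbelow a ha).ne⟩
    · by_contra hab
      exact hsinj a ha b hb hab h
  have hlt := Set.ncard_sdiff_singleton_lt_of_mem hΛB hBfin
  omega
end

section
/- For every ε > 0 there exist N ∈ ℕ and δ > 0 such that for every t ∈ [0, δ] and every ξ ∈ H with Σ_{n∈ℕ} α_n(t)|⟨e_n(t), ξ⟩|² < ∞, one has ‖ξ − P_N(t)ξ‖ ≤ ε · DN_t(ξ), where P_N(t) is the orthogonal projection onto span{e_n(t) : n < N} and DN_t(ξ) := ‖ξ‖ + (Σ_{n∈ℕ} α_n(t)|⟨e_n(t), ξ⟩|²)^{1/2}. -/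
open scoped InnerProductSpace

/-- A lower bound `L` on the weights from index `N` on bounds the tail of the Hilbert basis
expansion by the weighted `ℓ²` norm. -/
theorem HilbertBasis.mul_norm_sub_sum_sq_le
    {H : Type*} [NormedAddCommGroup H] [InnerProductSpace ℂ H]
    (b : HilbertBasis ℕ ℂ H) {a : ℕ → ℝ} (ha : ∀ n, 0 ≤ a n) {L : ℝ} {N : ℕ}
    (hL : ∀ n, N ≤ n → L ≤ a n) (ξ : H)
    (hs : Summable (fun n => a n * ‖⟪b n, ξ⟫_ℂ‖ ^ 2)) :
    L * ‖ξ - ∑ n ∈ Finset.range N, ⟪b n, ξ⟫_ℂ • b n‖ ^ 2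
      ≤ ∑' n, a n * ‖⟪b n, ξ⟫_ℂ‖ ^ 2 := by
  set η := ξ - ∑ n ∈ Finset.range N, ⟪b n, ξ⟫_ℂ • b n with hη
  have hcoef : ∀ n, ⟪b n, η⟫_ℂ = if n < N then 0 else ⟪b n, ξ⟫_ℂ := by
    intro n
    rw [hη, inner_sub_right, inner_sum]
    simp only [inner_smul_right, orthonormal_iff_ite.mp b.orthonormal, mul_ite, mul_one, mul_zero,
      Finset.sum_ite_eq, Finset.mem_range]
    split_ifs <;> simp
  have hsum : HasSum (fun n => ‖⟪b n, η⟫_ℂ‖ ^ 2) (‖η‖ ^ 2) := by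
    have h := (b.hasSum_inner_mul_inner η η).mapL Complex.reCLM
    convert h using 1
    · funext n
      rw [← inner_conj_symm η (b n), ← Complex.normSq_eq_conj_mul_self, ← Complex.sq_norm]
      simp
      norm_cast
    · rw [inner_self_eq_norm_sq_to_K]
      simp
      norm_cast
  refine hasSum_le (fun n => ?_) (hsum.mul_left L) hs.hasSum
  rw [hcoef]
  split_ifs with h
  · simpa using mul_nonneg (ha n) (sq_nonneg _)
  · exact mul_le_mul_of_nonneg_right (hL n (not_lt.mp h)) (sq_nonneg _)

/-- If the number of distinct values below each level is locally constant at `0`, then all but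
finitely many branches stay above a given level on a common neighbourhood of `0`. -/
theorem exists_forall_lt_of_ncard_eq
    (α : ℕ → ℝ → ℝ)
    (hcont : ∀ n, ContinuousOn (α n) (Set.Icc (0 : ℝ) 1))
    (hnonneg : ∀ n, ∀ t ∈ Set.Icc (0 : ℝ) 1, 0 ≤ α n t)
    (hmono : Monotone fun n => α n 0)
    (htend : ∀ t ∈ Set.Icc (0 : ℝ) 1,
      Filter.Tendsto (fun n => α n t) Filter.atTop Filter.atTop)
    (hcard : ∀ Λ : ℝ, 0 < Λ → ∃ δ > 0, ∀ t ∈ Set.Ico (0 : ℝ) δ, t ∈ Set.Icc (0 : ℝ) 1 →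
      ((Set.range fun n => α n t) ∩ Set.Icc 0 Λ).ncard
        = ((Set.range fun n => α n 0) ∩ Set.Icc 0 Λ).ncard)
    {L : ℝ} (hL : 0 ≤ L) :
    ∃ N : ℕ, ∃ δ > (0 : ℝ), ∀ t ∈ Set.Ico (0 : ℝ) δ, t ∈ Set.Icc (0 : ℝ) 1 →
      ∀ n, N ≤ n → L < α n t := by
  classical
  have h0 : (0 : ℝ) ∈ Set.Icc (0 : ℝ) 1 := by simp
  have hex : ∃ n, L < α n 0 := ((htend 0 h0).eventually_gt_atTop L).exists
  obtain ⟨N, hN, hlt⟩ : ∃ N, L < α N 0 ∧ ∀ m < N, α m 0 ≤ L :=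
    ⟨Nat.find hex, Nat.find_spec hex, fun m hm => not_lt.mp (Nat.find_min hex hm)⟩
  obtain ⟨a, hLa, haN⟩ := exists_between hN
  obtain ⟨Λ, haΛ, hΛN⟩ := exists_between haN
  obtain ⟨δ₁, hδ₁, hc⟩ := hcard Λ (by linarith)
  have hlow : ∀ᶠ t in nhdsWithin 0 (Set.Icc (0 : ℝ) 1), ∀ m ∈ Finset.range N, α m t < a := by
    rw [Filter.eventually_all_finset]
    intro m hm
    exact (hcont m 0 h0).eventually_lt_const ((hlt m (Finset.mem_range.mp hm)).trans_lt hLa)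
  have hsep : ∀ᶠ t in nhdsWithin 0 (Set.Icc (0 : ℝ) 1), ∀ m ∈ Finset.range N,
      ∀ k ∈ Finset.range N, α m 0 ≠ α k 0 → α m t ≠ α k t := by
    rw [Filter.eventually_all_finset]
    intro m _
    rw [Filter.eventually_all_finset]
    intro k _
    by_cases h : α m 0 = α k 0
    · simp [h]
    · filter_upwards [((hcont m 0 h0).sub (hcont k 0 h0)).eventually_ne
        (sub_ne_zero.mpr h)] with t ht _
      exact sub_ne_zero.mp ht
  obtain ⟨δ₂, hδ₂, hball⟩ := Metric.mem_nhdsWithin_iff.mp (hlow.and hsep)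
  have hgap : ∀ t ∈ Set.Ico (0 : ℝ) (min δ₁ δ₂), t ∈ Set.Icc (0 : ℝ) 1 → ∀ n, α n t ≠ Λ := by
    intro t ht ht1 n hn
    obtain ⟨hlow', hsep'⟩ : (∀ m ∈ Finset.range N, α m t < a) ∧ ∀ m ∈ Finset.range N,
        ∀ k ∈ Finset.range N, α m 0 ≠ α k 0 → α m t ≠ α k t := by
      refine hball ⟨?_, ht1⟩
      rw [Metric.mem_ball, Real.dist_eq, sub_zero, abs_of_nonneg ht.1]
      exact ht.2.trans_le (min_le_right _ _)
    set S := fun s => (Finset.range N).image fun m => α m s with hS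
    have hS0 : (Set.range fun n => α n 0) ∩ Set.Icc 0 Λ = S 0 := by
      ext v
      simp only [hS, Finset.coe_image, Set.mem_inter_iff, Set.mem_range, Set.mem_image,
        Finset.coe_range, Set.mem_Iio, Set.mem_Icc]
      constructor
      · rintro ⟨⟨m, rfl⟩, -, hm⟩
        exact ⟨m, lt_of_not_ge fun h => (hΛN.trans_le (hmono h)).not_ge hm, rfl⟩
      · rintro ⟨m, hm, rfl⟩
        exact ⟨⟨m, rfl⟩, hnonneg m 0 h0, by linarith [hlt m hm]⟩
    have hcardS : (S 0).card ≤ (S t).card := by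
      have hr : ∀ v ∈ S 0, ∃ m ∈ Finset.range N, α m 0 = v := fun v hv => Finset.mem_image.mp hv
      choose! r hrN hr0 using hr
      refine Finset.card_le_card_of_injOn (fun v => α (r v) t)
        (fun v hv => Finset.mem_image_of_mem _ (hrN v hv)) fun v hv w hw hvw => ?_
      by_contra hne
      exact hsep' _ (hrN v hv) _ (hrN w hw) (by rwa [hr0 v hv, hr0 w hw]) hvw
    have hsub : (S t : Set ℝ) ⊆ (Set.range fun n => α n t) ∩ Set.Icc 0 Λ := by
      intro v hv
      obtain ⟨m, hm, rfl⟩ := Finset.mem_image.mp (Finset.mem_coe.mp hv)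
      exact ⟨⟨m, rfl⟩, hnonneg m t ht1, ((hlow' m hm).trans haΛ).le⟩
    have hfin : ((Set.range fun n => α n t) ∩ Set.Icc 0 Λ).Finite := by
      have hev := (htend t ht1).eventually_gt_atTop Λ
      rw [← Nat.cofinite_eq_atTop, Filter.eventually_cofinite] at hev
      refine (hev.image fun n => α n t).subset ?_
      rintro _ ⟨⟨m, rfl⟩, -, hm⟩
      exact ⟨m, not_lt.mpr hm, rfl⟩
    have heq := Set.eq_of_subset_of_ncard_le hsub (by
      rw [hc t ⟨ht.1, ht.2.trans_le (min_le_left _ _)⟩ ht1, hS0, Set.ncard_coe_finset,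
        Set.ncard_coe_finset]
      exact hcardS) hfin
    have hmem : Λ ∈ (S t : Set ℝ) := by
      rw [heq]
      exact ⟨⟨n, hn⟩, by linarith, le_rfl⟩
    obtain ⟨m, hm, hmΛ⟩ := Finset.mem_image.mp (Finset.mem_coe.mp hmem)
    linarith [hlow' m hm]
  refine ⟨N, min δ₁ δ₂, lt_min hδ₁ hδ₂, fun t ht ht1 n hn => ?_⟩
  by_contra! hle
  have hn0 : Λ < α n 0 := hΛN.trans_le (hmono hn)
  obtain ⟨s, hs, hsΛ⟩ := intermediate_value_Icc' ht.1
    ((hcont n).mono (Set.Icc_subset_Icc_right ht1.2)) ⟨by linarith, hn0.le⟩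
  exact hgap s ⟨hs.1, hs.2.trans_lt ht.2⟩ ⟨hs.1, hs.2.trans ht1.2⟩ n hsΛ

/-- Lemma 3.3 (uniform truncation): under Hypothesis (A), vectors of controlled
graph norm are uniformly approximated by their truncations onto the span of the
first `N` eigenvectors. -/
theorem uniform_truncation
    {H : Type*} [NormedAddCommGroup H] [InnerProductSpace ℂ H] [CompleteSpace H]
    (e : ℝ → HilbertBasis ℕ ℂ H)
    (α : ℕ → ℝ → ℝ)
    (hcont : ∀ n, ContinuousOn (α n) (Set.Icc (0 : ℝ) 1))
    (hnonneg : ∀ n, ∀ t ∈ Set.Icc (0 : ℝ) 1, 0 ≤ α n t)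
    (hmono : Monotone fun n => α n 0)
    (htend : ∀ t ∈ Set.Icc (0 : ℝ) 1,
      Filter.Tendsto (fun n => α n t) Filter.atTop Filter.atTop)
    (hcard : ∀ Λ : ℝ, 0 < Λ → ∃ δ > 0, ∀ t ∈ Set.Ico (0 : ℝ) δ, t ∈ Set.Icc (0 : ℝ) 1 →
      ((Set.range fun n => α n t) ∩ Set.Icc 0 Λ).ncard
        = ((Set.range fun n => α n 0) ∩ Set.Icc 0 Λ).ncard) :
    ∀ ε > (0 : ℝ), ∃ N : ℕ, ∃ δ > (0 : ℝ),
      ∀ t ∈ Set.Icc (0 : ℝ) δ, t ∈ Set.Icc (0 : ℝ) 1 →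
        ∀ ξ : H, Summable (fun n => α n t * ‖⟪e t n, ξ⟫_ℂ‖ ^ 2) →
          ‖ξ - ∑ n ∈ Finset.range N, ⟪e t n, ξ⟫_ℂ • e t n‖
            ≤ ε * (‖ξ‖ + Real.sqrt (∑' n, α n t * ‖⟪e t n, ξ⟫_ℂ‖ ^ 2)) := by
  intro ε hε
  obtain ⟨N, δ, hδ, h⟩ := exists_forall_lt_of_ncard_eq α hcont hnonneg hmono htend hcard
    (L := (ε ^ 2)⁻¹) (by positivity)
  refine ⟨N, δ / 2, by positivity, fun t ht ht1 ξ hs => ?_⟩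
  have hle := (e t).mul_norm_sub_sum_sq_le (fun n => hnonneg n t ht1)
    (fun n hn => (h t ⟨ht.1, by linarith [ht.2]⟩ ht1 n hn).le) ξ hs
  rw [inv_mul_le_iff₀ (by positivity)] at hle
  calc ‖ξ - ∑ n ∈ Finset.range N, ⟪e t n, ξ⟫_ℂ • e t n‖
      ≤ Real.sqrt (ε ^ 2 * ∑' n, α n t * ‖⟪e t n, ξ⟫_ℂ‖ ^ 2) := Real.le_sqrt_of_sq_le hle
    _ = ε * Real.sqrt (∑' n, α n t * ‖⟪e t n, ξ⟫_ℂ‖ ^ 2) := by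
      rw [Real.sqrt_mul (by positivity), Real.sqrt_sq hε.le]
    _ ≤ ε * (‖ξ‖ + Real.sqrt (∑' n, α n t * ‖⟪e t n, ξ⟫_ℂ‖ ^ 2)) := by
      gcongr
      exact le_add_of_nonneg_left (norm_nonneg ξ)
end

section
/- Let H be a complex Hilbert space, ε > 0, N ∈ ℕ, let (e_n)_{n=0}^N and (f_n)_{n=0}^N be orthonormal families in H, and let ξ ∈ H with ‖ξ‖ ≤ 1. Assume ‖ξ − Σ_{n=0}^N ⟨ξ, e_n⟩ e_n‖ ≤ ε/6 and ‖e_n − f_n‖ ≤ ε/(12(N+1)) for every 0 ≤ n ≤ N. Set η := (6/(6+ε))·Σ_{n=0}^N ⟨ξ, e_n⟩ f_n. Then ‖ξ − η‖ ≤ ε/2. -/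
open scoped InnerProductSpace

/-- Bessel's inequality, transported along a second orthonormal family. -/
theorem Orthonormal.norm_sum_inner_smul_le {𝕜 E F ι : Type*} [RCLike 𝕜]
    [NormedAddCommGroup E] [InnerProductSpace 𝕜 E]
    [NormedAddCommGroup F] [InnerProductSpace 𝕜 F] [Fintype ι]
    {e : ι → E} {f : ι → F} (he : Orthonormal 𝕜 e) (hf : Orthonormal 𝕜 f) (x : E) :
    ‖∑ j, inner 𝕜 (e j) x • f j‖ ≤ ‖x‖ := by
  have hsq : ‖∑ j, inner 𝕜 (e j) x • f j‖ ^ 2 = ∑ j, ‖inner 𝕜 (e j) x‖ ^ 2 := by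
    have h := hf.inner_sum (fun j => inner 𝕜 (e j) x) (fun j => inner 𝕜 (e j) x) Finset.univ
    rw [inner_self_eq_norm_sq_to_K] at h
    simp only [RCLike.conj_mul] at h
    exact_mod_cast h
  refine (sq_le_sq₀ (norm_nonneg _) (norm_nonneg _)).1 ?_
  rw [hsq]
  exact he.sum_inner_products_le x

/-- The key approximation step in the proof of the main theorem: truncating a
unit vector `ξ` onto the first `N+1` eigenvectors `e`, replacing them by the
nearby eigenvectors `f`, and rescaling by `6/(6+ε)`, yields a vector within
`ε/2` of `ξ`. -/
theorem companion_vector_approximation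
    {H : Type*} [NormedAddCommGroup H] [InnerProductSpace ℂ H] [CompleteSpace H]
    (ε : ℝ) (hε : 0 < ε) (N : ℕ)
    (e f : Fin (N + 1) → H) (he : Orthonormal ℂ e) (hf : Orthonormal ℂ f)
    (ξ : H) (hξ : ‖ξ‖ ≤ 1)
    (htrunc : ‖ξ - ∑ j, ⟪e j, ξ⟫_ℂ • e j‖ ≤ ε / 6)
    (hclose : ∀ j, ‖e j - f j‖ ≤ ε / (12 * (N + 1))) :
    ‖ξ - ((6 / (6 + ε) : ℝ) : ℂ) • ∑ j, ⟪e j, ξ⟫_ℂ • f j‖ ≤ ε / 2 := by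
  set S := ∑ j, ⟪e j, ξ⟫_ℂ • e j with hS
  set T := ∑ j, ⟪e j, ξ⟫_ℂ • f j with hT
  have hT_le : ‖T‖ ≤ 1 := (he.norm_sum_inner_smul_le hf ξ).trans hξ
  have hST : ‖S - T‖ ≤ ε / 12 := by
    rw [hS, hT, ← Finset.sum_sub_distrib]
    calc ‖∑ j, (⟪e j, ξ⟫_ℂ • e j - ⟪e j, ξ⟫_ℂ • f j)‖
        ≤ ∑ _j : Fin (N + 1), ε / (12 * (N + 1)) := by
          refine norm_sum_le_of_le _ fun j _ => ?_
          have hcoeff : ‖⟪e j, ξ⟫_ℂ‖ ≤ 1 := by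
            have h := norm_inner_le_norm (𝕜 := ℂ) (e j) ξ
            rw [he.1 j, one_mul] at h
            exact h.trans hξ
          rw [← smul_sub, norm_smul]
          exact (mul_le_of_le_one_left (norm_nonneg _) hcoeff).trans (hclose j)
      _ = ε / 12 := by
          simp only [Finset.sum_const, Finset.card_univ, Fintype.card_fin, nsmul_eq_mul]
          push_cast
          field_simp
  have hscale : ‖T - ((6 / (6 + ε) : ℝ) : ℂ) • T‖ ≤ ε / 6 := by
    have hfactor : T - ((6 / (6 + ε) : ℝ) : ℂ) • T = ((ε / (6 + ε) : ℝ) : ℂ) • T := by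
      have h : ε / (6 + ε) = 1 - 6 / (6 + ε) := by field_simp; ring
      rw [h, Complex.ofReal_sub, sub_smul, Complex.ofReal_one, one_smul]
    rw [hfactor, norm_smul, Complex.norm_real, Real.norm_of_nonneg (by positivity)]
    calc ε / (6 + ε) * ‖T‖ ≤ ε / (6 + ε) := mul_le_of_le_one_right (by positivity) hT_le
      _ ≤ ε / 6 := by gcongr; linarith
  have h₁ := norm_sub_le_norm_sub_add_norm_sub ξ S T
  have h₂ := norm_sub_le_norm_sub_add_norm_sub ξ T (((6 / (6 + ε) : ℝ) : ℂ) • T)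
  linarith
end
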